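/- arXiv:2504.06253 — 3 statements merged into one kernel-verified Lean document; each statement's English description precedes it below -/
import Mathlib

section
/- Let n ≥ 1 and let Q ∈ ℝ^{n×n} be symmetric such that some row sum of Q is nonzero, i.e., there exists an index i with ∑_{0≤j<n} Q_{i,j} ≠ 0. Then there do NOT exist a matrix J ∈ ℝ^{n×n} and a constant c ∈ ℝ such that for all y ∈ {-1,1}^n, ∑_{0≤i,j<n} Q_{i,j}·((y_i+1)/2)·((y_j+1)/2) = ∑_{0≤i,j<n} J_{i,j} y_i y_j + c. -/
/-- Twice the odd part of a symmetric QUBO cost, as a function of the spins, is the linear form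
given by the row sums. -/
theorem odd_part_qubo {ι : Type*} [Fintype ι] {Q : Matrix ι ι ℝ} (hQ : Q.IsSymm) (y : ι → ℝ) :
    (∑ i, ∑ j, Q i j * ((y i + 1) / 2) * ((y j + 1) / 2)) -
      (∑ i, ∑ j, Q i j * (((-y) i + 1) / 2) * (((-y) j + 1) / 2)) =
      ∑ i, y i * ∑ j, Q i j := by
  have hswap : ∑ i, ∑ j, y j * Q i j = ∑ i, ∑ j, y i * Q i j := by
    rw [Finset.sum_comm]
    simp_rw [hQ.apply]
  calc
    _ = ∑ i, ∑ j, (y i * Q i j / 2 + y j * Q i j / 2) := by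
      simp_rw [← Finset.sum_sub_distrib, Pi.neg_apply]
      refine Finset.sum_congr rfl fun i _ => Finset.sum_congr rfl fun j _ => ?_
      ring
    _ = (∑ i, ∑ j, y i * Q i j) / 2 + (∑ i, ∑ j, y j * Q i j) / 2 := by
      simp_rw [Finset.sum_add_distrib, Finset.sum_div]
    _ = ∑ i, y i * ∑ j, Q i j := by
      rw [hswap, add_halves]
      simp_rw [Finset.mul_sum]

/-- If some row sum of the symmetric matrix `Q` is nonzero, then there is no
Ising matrix `J` and constant `c` reproducing the QUBO objective on all spin vectors. -/
theorem stmt_1 (n : ℕ) (hn : 1 ≤ n) (Q : Matrix (Fin n) (Fin n) ℝ) (hQ : Q.IsSymm)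
    (hrow : ∃ i, (∑ j, Q i j) ≠ 0) :
    ¬ ∃ (J : Matrix (Fin n) (Fin n) ℝ) (c : ℝ),
        ∀ y : Fin n → ℝ, (∀ i, y i = -1 ∨ y i = 1) →
          ∑ i, ∑ j, Q i j * ((y i + 1) / 2) * ((y j + 1) / 2) =
            (∑ i, ∑ j, J i j * y i * y j) + c := by
  rintro ⟨J, c, h⟩
  obtain ⟨i₀, hi₀⟩ := hrow
  apply hi₀
  set y : Fin n → ℝ := fun i => if 0 ≤ ∑ j, Q i j then 1 else -1 with hy
  have hspin : ∀ i, y i = -1 ∨ y i = 1 := fun i => by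
    by_cases hi : 0 ≤ ∑ j, Q i j <;> simp [hy, hi]
  have hspin_neg : ∀ i, (-y) i = -1 ∨ (-y) i = 1 := fun i => by
    rcases hspin i with hi | hi <;> simp [hi]
  have hodd := odd_part_qubo hQ y
  have hJ : ∑ i, ∑ j, J i j * (-y) i * (-y) j = ∑ i, ∑ j, J i j * y i * y j := by
    simp
  rw [h y hspin, h (-y) hspin_neg, hJ, sub_self] at hodd
  have hterm : ∀ i, y i * ∑ j, Q i j = |∑ j, Q i j| := fun i => by
    by_cases hi : 0 ≤ ∑ j, Q i j
    · simp [hy, hi, abs_of_nonneg hi]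
    · simp [hy, hi, abs_of_neg (not_le.mp hi)]
  simp_rw [hterm] at hodd
  exact abs_eq_zero.mp
    ((Finset.sum_eq_zero_iff_of_nonneg fun i _ => abs_nonneg _).mp hodd.symm i₀
      (Finset.mem_univ i₀))
end

section
/- Let n ≥ 1 and let Q ∈ ℝ^{n×n} be symmetric. Define the symmetric matrix A ∈ ℝ^{(n+1)×(n+1)} by A_{i,j} = −Q_{i,j} for 0 ≤ i,j < n, A_{n,i} = A_{i,n} = ∑_{0≤j<n} Q_{i,j} for 0 ≤ i < n, and A_{n,n} = 0. Then max_{x ∈ {0,1}^n} xᵀQx = max_{y ∈ {-1,1}^{n+1}} yᵀ(−A/4)y + (1/4)·sum(Q). -/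
/-- The real number (0 or 1) encoded by a boolean binary variable. -/
def bitR (b : Bool) : ℝ := if b then 1 else 0

/-- The real spin (+1 or -1) encoded by a boolean spin variable. -/
def spinR (b : Bool) : ℝ := if b then 1 else -1

theorem bitR_xor (a b : Bool) : bitR (xor a b) = (1 - spinR b * spinR a) / 2 := by
  cases a <;> cases b <;> norm_num [bitR, spinR]

theorem spinR_mul_self (b : Bool) : spinR b * spinR b = 1 := by
  cases b <;> norm_num [spinR]

/-- The Ising energy of `-A/4` at `y`, shifted by `sum(Q)/4`, is the QUBO energy of `Q` at the
bits recording which spins differ from the last one. -/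
theorem ising_add_const_eq_qubo {n : ℕ} {Q : Matrix (Fin n) (Fin n) ℝ} (hQ : Q.IsSymm)
    {A : Matrix (Fin (n + 1)) (Fin (n + 1)) ℝ}
    (hA₁ : ∀ i j : Fin n, A i.castSucc j.castSucc = -Q i j)
    (hA₂ : ∀ i : Fin n, A (Fin.last n) i.castSucc = ∑ j, Q i j)
    (hA₃ : ∀ i : Fin n, A i.castSucc (Fin.last n) = ∑ j, Q i j)
    (hA₄ : A (Fin.last n) (Fin.last n) = 0) (y : Fin (n + 1) → Bool) :
    ∑ i, ∑ j, spinR (y i) * (-(A i j) / 4) * spinR (y j) + (1 / 4) * ∑ i, ∑ j, Q i j =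
      ∑ i, ∑ j, bitR (xor (y (Fin.castSucc i)) (y (Fin.last n))) * Q i j *
        bitR (xor (y (Fin.castSucc j)) (y (Fin.last n))) := by
  simp only [Fin.sum_univ_castSucc, hA₁, hA₂, hA₃, hA₄, bitR_xor]
  have ht := spinR_mul_self (y (Fin.last n))
  generalize spinR (y (Fin.last n)) = t at ht ⊢
  have h_col : ∑ j : Fin n, t * (-(∑ k, Q j k) / 4) * spinR (y j.castSucc) =
      ∑ i, ∑ j : Fin n, t * (-(Q i j) / 4) * spinR (y j.castSucc) := by
    rw [Finset.sum_comm]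
    refine Finset.sum_congr rfl fun j _ => ?_
    simp only [← Finset.sum_mul, ← Finset.mul_sum, ← Finset.sum_div, Finset.sum_neg_distrib,
      hQ.apply]
  have h_row (i : Fin n) : spinR (y i.castSucc) * (-(∑ j, Q i j) / 4) * t =
      ∑ j, spinR (y i.castSucc) * (-(Q i j) / 4) * t := by
    simp only [← Finset.sum_mul, ← Finset.mul_sum, ← Finset.sum_div, Finset.sum_neg_distrib]
  rw [h_col, neg_zero, zero_div, mul_zero, zero_mul, add_zero]
  simp only [h_row, Finset.mul_sum, ← Finset.sum_add_distrib]
  refine Finset.sum_congr rfl fun i _ => Finset.sum_congr rfl fun j _ => ?_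
  linear_combination (-(spinR (y i.castSucc) * spinR (y j.castSucc) * Q i j) / 4) * ht

/-- The optimal QUBO value of `Q` over `{0,1}^n` equals the optimal
Ising value of `-A/4` over `{-1,1}^(n+1)` plus `sum(Q)/4`, where `A` is the
adjacency matrix of the corresponding graph of `Q`. -/
theorem stmt_8 (n : ℕ) (hn : 1 ≤ n) (Q : Matrix (Fin n) (Fin n) ℝ) (hQ : Q.IsSymm)
    (A : Matrix (Fin (n + 1)) (Fin (n + 1)) ℝ)
    (hA₁ : ∀ i j : Fin n, A i.castSucc j.castSucc = -Q i j)
    (hA₂ : ∀ i : Fin n, A (Fin.last n) i.castSucc = ∑ j, Q i j)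
    (hA₃ : ∀ i : Fin n, A i.castSucc (Fin.last n) = ∑ j, Q i j)
    (hA₄ : A (Fin.last n) (Fin.last n) = 0) :
    Finset.univ.sup' Finset.univ_nonempty
        (fun x : Fin n → Bool => ∑ i, ∑ j, bitR (x i) * Q i j * bitR (x j)) =
      Finset.univ.sup' Finset.univ_nonempty
          (fun y : Fin (n + 1) → Bool =>
            ∑ i, ∑ j, spinR (y i) * (-(A i j) / 4) * spinR (y j)) +
        (1 / 4) * ∑ i, ∑ j, Q i j := by
  have h := ising_add_const_eq_qubo hQ hA₁ hA₂ hA₃ hA₄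
  apply le_antisymm
  · refine Finset.sup'_le _ _ fun x _ => ?_
    have hx := h (Fin.snoc x false)
    simp only [Fin.snoc_castSucc, Fin.snoc_last, Bool.xor_false] at hx
    rw [← hx]
    gcongr
    exact Finset.le_sup' (fun y : Fin (n + 1) → Bool =>
      ∑ i, ∑ j, spinR (y i) * (-(A i j) / 4) * spinR (y j)) (Finset.mem_univ _)
  · rw [← le_sub_iff_add_le]
    refine Finset.sup'_le _ _ fun y _ => ?_
    rw [le_sub_iff_add_le, h y]
    exact Finset.le_sup' (fun x : Fin n → Bool => ∑ i, ∑ j, bitR (x i) * Q i j * bitR (x j))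
      (Finset.mem_univ fun i => xor (y (Fin.castSucc i)) (y (Fin.last n)))
end

section
/- Let n ≥ 1 and let Q ∈ ℝ^{n×n} be symmetric, with corresponding matrix A ∈ ℝ^{(n+1)×(n+1)} defined by A_{i,j} = −Q_{i,j} for 0 ≤ i,j < n, A_{n,i} = A_{i,n} = ∑_{0≤j<n} Q_{i,j} for 0 ≤ i < n, and A_{n,n} = 0. Let y ∈ {-1,1}^{n+1} and let x ∈ {0,1}^n be given by x_i = (1 − y_i y_n)/2. Then x maximizes xᵀQx over {0,1}^n if and only if y maximizes yᵀ(−A/4)y over {-1,1}^{n+1}. -/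
/-- With `x i = (1 - y i * y n) / 2`, the Ising objective of `-A/4` at a vector `y` whose last
spin squares to one is the QUBO objective of `Q` at `x`, up to a constant. -/
theorem ising_eq_qubo_sub {n : ℕ} {Q : Matrix (Fin n) (Fin n) ℝ} (hQ : Q.IsSymm)
    {A : Matrix (Fin (n + 1)) (Fin (n + 1)) ℝ}
    (hA₁ : ∀ i j : Fin n, A i.castSucc j.castSucc = -Q i j)
    (hA₂ : ∀ i : Fin n, A (Fin.last n) i.castSucc = ∑ j, Q i j)
    (hA₃ : ∀ i : Fin n, A i.castSucc (Fin.last n) = ∑ j, Q i j)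
    (hA₄ : A (Fin.last n) (Fin.last n) = 0)
    {y : Fin (n + 1) → ℝ} (hy : y (Fin.last n) * y (Fin.last n) = 1)
    {x : Fin n → ℝ} (hx : ∀ i, x i = (1 - y i.castSucc * y (Fin.last n)) / 2) :
    ∑ i, ∑ j, y i * (-(A i j) / 4) * y j =
      ∑ i, ∑ j, x i * Q i j * x j - (∑ i, ∑ j, Q i j) / 4 := by
  have hrow : ∑ i : Fin n, y (Fin.last n) * (-(∑ j, Q i j) / 4) * y i.castSucc =
      ∑ i, ∑ j, y (Fin.last n) * (-Q i j / 4) * y j.castSucc := by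
    rw [Finset.sum_comm]
    refine Finset.sum_congr rfl fun i _ => ?_
    rw [← Finset.sum_mul, ← Finset.mul_sum, ← Finset.sum_div, Finset.sum_neg_distrib]
    simp only [hQ.apply]
  have hcol : ∑ i : Fin n, y i.castSucc * (-(∑ j, Q i j) / 4) * y (Fin.last n) =
      ∑ i, ∑ j, y i.castSucc * (-Q i j / 4) * y (Fin.last n) := by
    refine Finset.sum_congr rfl fun i _ => ?_
    rw [← Finset.sum_mul, ← Finset.mul_sum, ← Finset.sum_div, Finset.sum_neg_distrib]
  simp only [Fin.sum_univ_castSucc, hA₁, hA₂, hA₃, hA₄, Finset.sum_add_distrib]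
  rw [hrow, hcol]
  simp only [Finset.sum_div, neg_zero, zero_div, mul_zero, zero_mul, add_zero,
    ← Finset.sum_add_distrib, ← Finset.sum_sub_distrib]
  refine Finset.sum_congr rfl fun i _ => Finset.sum_congr rfl fun j _ => ?_
  rw [hx, hx]
  linear_combination (-(y i.castSucc * Q i j * y j.castSucc) / 4) * hy


/-- The spin vector `y` maximizes the Ising objective of `-A/4` over
`{-1,1}^(n+1)` if and only if the corresponding binary vector `x` (given by
`x i = (1 - y i * y n)/2`) maximizes the QUBO objective of `Q` over `{0,1}^n`. -/
theorem stmt_10 (n : ℕ) (hn : 1 ≤ n) (Q : Matrix (Fin n) (Fin n) ℝ) (hQ : Q.IsSymm)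
    (A : Matrix (Fin (n + 1)) (Fin (n + 1)) ℝ)
    (hA₁ : ∀ i j : Fin n, A i.castSucc j.castSucc = -Q i j)
    (hA₂ : ∀ i : Fin n, A (Fin.last n) i.castSucc = ∑ j, Q i j)
    (hA₃ : ∀ i : Fin n, A i.castSucc (Fin.last n) = ∑ j, Q i j)
    (hA₄ : A (Fin.last n) (Fin.last n) = 0)
    (y : Fin (n + 1) → ℝ) (hy : ∀ i, y i = -1 ∨ y i = 1)
    (x : Fin n → ℝ) (hx : ∀ i, x i = (1 - y i.castSucc * y (Fin.last n)) / 2) :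
    (∀ x' : Fin n → ℝ, (∀ i, x' i = 0 ∨ x' i = 1) →
        ∑ i, ∑ j, x' i * Q i j * x' j ≤ ∑ i, ∑ j, x i * Q i j * x j) ↔
      (∀ y' : Fin (n + 1) → ℝ, (∀ i, y' i = -1 ∨ y' i = 1) →
        ∑ i, ∑ j, y' i * (-(A i j) / 4) * y' j ≤ ∑ i, ∑ j, y i * (-(A i j) / 4) * y j) := by
  have sq {t : ℝ} (ht : t = -1 ∨ t = 1) : t * t = 1 := by rcases ht with rfl | rfl <;> norm_num
  have key := fun (z : Fin (n + 1) → ℝ) (hz : ∀ i, z i = -1 ∨ z i = 1) (w : Fin n → ℝ)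
    (hw : ∀ i, w i = (1 - z i.castSucc * z (Fin.last n)) / 2) =>
      ising_eq_qubo_sub hQ hA₁ hA₂ hA₃ hA₄ (sq (hz (Fin.last n))) hw
  constructor
  · intro h y' hy'
    rw [key y hy x hx, key y' hy' _ fun _ => rfl]
    refine sub_le_sub_right (h _ fun i => ?_) _
    rcases hy' i.castSucc with h₁ | h₁ <;> rcases hy' (Fin.last n) with h₂ | h₂ <;>
      norm_num [h₁, h₂]
  · intro h x' hx'
    let y' : Fin (n + 1) → ℝ := Fin.snoc (fun i => 1 - 2 * x' i) 1
    have hy' : ∀ i, y' i = -1 ∨ y' i = 1 := by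
      refine Fin.lastCases (by simp [y']) fun i => ?_
      rcases hx' i with h₁ | h₁ <;> norm_num [y', h₁]
    have hle := h y' hy'
    rw [key y hy x hx, key y' hy' x' fun i => by simp [y']] at hle
    exact (sub_le_sub_iff_right _).1 hle
end
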